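/- arXiv:2506.09775 — 6 statements merged into one kernel-verified Lean document; each statement's English description precedes it below -/
import Mathlib

section
/- Let ξ > 0 and define ψ : [0,1] → ℝ by ψ(s) := ξ·√(1 − s²)/arccos(s) for 0 ≤ s < 1 and ψ(1) := ξ. Then ψ is Lipschitz continuous with constant 4ξ/π²; that is, |ψ(s₁) − ψ(s₂)| ≤ (4ξ/π²)·|s₁ − s₂| for all s₁, s₂ ∈ [0,1]. -/
/-- `ψ(s) = ξ·√(1 - s²)/arccos(s)` for `0 ≤ s < 1`, continuously extended by `ψ(1) = ξ`. -/
noncomputable def psiFun (ξ s : ℝ) : ℝ :=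
  if s = 1 then ξ else ξ * Real.sqrt (1 - s ^ 2) / Real.arccos s

open Real Set

/-- `((8 / π²) - 1) sin x + (4 / π²) x cos x`, a factor of the derivative of
`(4 / π²) x² sin x - (sin x - x cos x)`, is concave on `[0, π/2]`. -/
lemma concaveOn_sin_add_mul_cos :
    ConcaveOn ℝ (Icc 0 (π / 2))
      (fun x => (2 * (4 / π ^ 2) - 1) * sin x + 4 / π ^ 2 * (x * cos x)) := by
  have hc : 1 ≤ 4 * (4 / π ^ 2) := by
    rw [← mul_div_assoc, le_div_iff₀ (by positivity)]
    nlinarith [pi_pos, pi_le_four]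
  have hc0 : 0 < 4 / π ^ 2 := by positivity
  generalize 4 / π ^ 2 = c at *
  refine concaveOn_of_hasDerivWithinAt2_nonpos (convex_Icc _ _) (by fun_prop)
    (f' := fun x => (3 * c - 1) * cos x - c * (x * sin x))
    (f'' := fun x => -((4 * c - 1) * sin x + c * (x * cos x))) ?_ ?_ ?_
  · intro x _
    refine HasDerivAt.hasDerivWithinAt <| HasDerivAt.congr_deriv
      (((hasDerivAt_sin x).const_mul (2 * c - 1)).add
        (((hasDerivAt_id' x).mul (hasDerivAt_cos x)).const_mul c)) ?_
    ring
  · intro x _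
    refine HasDerivAt.hasDerivWithinAt <| HasDerivAt.congr_deriv
      (((hasDerivAt_cos x).const_mul (3 * c - 1)).sub
        (((hasDerivAt_id' x).mul (hasDerivAt_sin x)).const_mul c)) ?_
    ring
  · intro x hx
    rw [interior_Icc] at hx
    have hs : 0 ≤ sin x := sin_nonneg_of_nonneg_of_le_pi hx.1.le (by linarith [hx.2, pi_pos])
    have hcos : 0 ≤ cos x := cos_nonneg_of_mem_Icc ⟨by linarith [hx.1, pi_pos], hx.2.le⟩
    have h₁ := mul_nonneg (sub_nonneg.2 hc) hs
    have h₂ := mul_nonneg hc0.le (mul_nonneg hx.1.le hcos)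
    linarith

lemma sin_sub_mul_cos_le {t : ℝ} (ht : t ∈ Icc 0 (π / 2)) :
    sin t - t * cos t ≤ 4 / π ^ 2 * (t ^ 2 * sin t) := by
  have hk := concaveOn_sin_add_mul_cos
  have hend : 4 / π ^ 2 * (π / 2) ^ 2 = 1 := by
    field_simp
    norm_num
  generalize 4 / π ^ 2 = c at *
  set k : ℝ → ℝ := fun x => (2 * c - 1) * sin x + c * (x * cos x) with hk_def
  set h : ℝ → ℝ := fun x => c * (x ^ 2 * sin x) - (sin x - x * cos x) with hh_def
  have hk0 : k 0 = 0 := by simp [hk_def]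
  have hder (x : ℝ) : HasDerivAt h (x * k x) x := by
    refine HasDerivAt.congr_deriv ((((hasDerivAt_pow 2 x).mul (hasDerivAt_sin x)).const_mul c).sub
      ((hasDerivAt_sin x).sub ((hasDerivAt_id' x).mul (hasDerivAt_cos x)))) ?_
    simp only [hk_def]
    push_cast
    ring
  have hcont : Continuous h := by fun_prop
  have hpi := pi_pos
  have h0mem : (0 : ℝ) ∈ Icc 0 (π / 2) := ⟨le_rfl, by positivity⟩
  suffices 0 ≤ h t from sub_nonneg.1 this
  rcases le_or_gt 0 (k t) with hkt | hkt
  · have hmono : MonotoneOn h (Icc 0 t) := by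
      refine monotoneOn_of_hasDerivWithinAt_nonneg (convex_Icc _ _) hcont.continuousOn
        (fun x _ => (hder x).hasDerivWithinAt) fun x hx => ?_
      have hx' := interior_subset hx
      have := hk.min_le_of_mem_Icc h0mem ht hx'
      rw [hk0, min_eq_left hkt] at this
      exact mul_nonneg hx'.1 this
    have := hmono (left_mem_Icc.2 ht.1) (right_mem_Icc.2 ht.1) ht.1
    simpa [hh_def] using this
  · have hanti : AntitoneOn h (Icc t (π / 2)) := by
      refine antitoneOn_of_hasDerivWithinAt_nonpos (convex_Icc _ _) hcont.continuousOn
        (fun x _ => (hder x).hasDerivWithinAt) fun x hx => ?_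
      have hx' := interior_subset hx
      refine mul_nonpos_of_nonneg_of_nonpos (ht.1.trans hx'.1) (le_of_not_gt fun hkx => ?_)
      have := hk.min_le_of_mem_Icc h0mem ⟨ht.1.trans hx'.1, hx'.2⟩ ⟨ht.1, hx'.1⟩
      rw [hk0, min_eq_left hkx.le] at this
      linarith
    have := hanti (left_mem_Icc.2 ht.2) (right_mem_Icc.2 ht.2) ht.2
    simpa [hh_def, hend, ← mul_assoc] using this

lemma hasDerivAt_sinc_of_ne_zero {x : ℝ} (hx : x ≠ 0) :
    HasDerivAt sinc ((x * cos x - sin x) / x ^ 2) x := by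
  have h : HasDerivAt (fun y => sin y / y) ((x * cos x - sin x) / x ^ 2) x := by
    refine HasDerivAt.congr_deriv ((hasDerivAt_sin x).div (hasDerivAt_id' x) hx) ?_
    ring
  refine h.congr_of_eventuallyEq ?_
  filter_upwards [isOpen_ne.mem_nhds hx] with y hy using sinc_of_ne_zero hy

lemma antitoneOn_sinc : AntitoneOn sinc (Icc 0 (π / 2)) := by
  refine antitoneOn_of_hasDerivWithinAt_nonpos (convex_Icc _ _) continuous_sinc.continuousOn
    (f' := fun x => (x * cos x - sin x) / x ^ 2) ?_ ?_
  all_goals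
    intro x hx
    rw [interior_Icc] at hx
  · exact (hasDerivAt_sinc_of_ne_zero hx.1.ne').hasDerivWithinAt
  · refine div_nonpos_of_nonpos_of_nonneg (sub_nonpos.2 ?_) (sq_nonneg x)
    have hcos : 0 < cos x := cos_pos_of_mem_Ioo ⟨by linarith [hx.1, pi_pos], hx.2⟩
    have := lt_tan hx.1 hx.2
    rw [tan_eq_sin_div_cos, lt_div_iff₀ hcos] at this
    exact this.le

lemma monotoneOn_sinc_sub_cos :
    MonotoneOn (fun x => sinc x - 4 / π ^ 2 * cos x) (Icc 0 (π / 2)) := by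
  refine monotoneOn_of_hasDerivWithinAt_nonneg (convex_Icc _ _)
    (continuous_sinc.sub (by fun_prop)).continuousOn
    (f' := fun x => (x * cos x - sin x) / x ^ 2 - 4 / π ^ 2 * -sin x) ?_ ?_
  · intro x hx
    rw [interior_Icc] at hx
    exact ((hasDerivAt_sinc_of_ne_zero hx.1.ne').sub
      ((hasDerivAt_cos x).const_mul _)).hasDerivWithinAt
  · intro x hx
    have h := sin_sub_mul_cos_le (interior_subset hx)
    rw [interior_Icc] at hx
    have hx0 := hx.1
    have : (x * cos x - sin x) / x ^ 2 - 4 / π ^ 2 * -sin x =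
        (4 / π ^ 2 * (x ^ 2 * sin x) - (sin x - x * cos x)) / x ^ 2 := by
      field_simp
      ring
    rw [this]
    exact div_nonneg (sub_nonneg.2 h) (sq_nonneg x)

lemma abs_sinc_sub_sinc_le {x y : ℝ} (hx : x ∈ Icc 0 (π / 2)) (hy : y ∈ Icc 0 (π / 2)) :
    |sinc x - sinc y| ≤ 4 / π ^ 2 * |cos x - cos y| := by
  wlog hxy : x ≤ y generalizing x y
  · rw [abs_sub_comm, abs_sub_comm (cos x)]
    exact this hy hx (le_of_not_ge hxy)
  have hanti := antitoneOn_sinc hx hy hxy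
  have hmono := monotoneOn_sinc_sub_cos hx hy hxy
  have hcos : cos y ≤ cos x := cos_le_cos_of_nonneg_of_le_pi hx.1 (by linarith [hy.2, pi_pos]) hxy
  rw [abs_of_nonneg (sub_nonneg.2 hanti), abs_of_nonneg (sub_nonneg.2 hcos)]
  simp only at hmono
  linarith

lemma psiFun_eq_mul_sinc (ξ : ℝ) {s : ℝ} (hs : s ≤ 1) : psiFun ξ s = ξ * sinc (arccos s) := by
  unfold psiFun
  split_ifs with h
  · simp [h]
  · have : arccos s ≠ 0 := (arccos_pos.2 (lt_of_le_of_ne hs h)).ne'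
    rw [sinc_of_ne_zero this, sin_arccos, mul_div_assoc]

/-- The function `ψ` is Lipschitz on `[0,1]` with constant `4ξ/π²`. -/
theorem psiFun_lipschitz (ξ : ℝ) (hξ : 0 < ξ) :
    ∀ s₁ ∈ Set.Icc (0 : ℝ) 1, ∀ s₂ ∈ Set.Icc (0 : ℝ) 1,
      |psiFun ξ s₁ - psiFun ξ s₂| ≤ 4 * ξ / Real.pi ^ 2 * |s₁ - s₂| := by
  intro s₁ h₁ s₂ h₂
  have hmem {s : ℝ} (hs : s ∈ Icc (0 : ℝ) 1) : arccos s ∈ Icc 0 (π / 2) :=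
    ⟨arccos_nonneg s, arccos_le_pi_div_two.2 hs.1⟩
  have h := abs_sinc_sub_sinc_le (hmem h₁) (hmem h₂)
  rw [cos_arccos (by linarith [h₁.1]) h₁.2, cos_arccos (by linarith [h₂.1]) h₂.2] at h
  rw [psiFun_eq_mul_sinc ξ h₁.2, psiFun_eq_mul_sinc ξ h₂.2, ← mul_sub, abs_mul, abs_of_pos hξ]
  calc ξ * |sinc (arccos s₁) - sinc (arccos s₂)| ≤ ξ * (4 / π ^ 2 * |s₁ - s₂|) := by gcongr
    _ = 4 * ξ / π ^ 2 * |s₁ - s₂| := by ring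
end

section
/- Let x, y₁, y₂ ∈ ℝⁿ with ‖x‖₂ = ‖y₁‖₂ = ‖y₂‖₂ = 1, and let t₁, t₂ ≥ 0. Suppose that for i = 1, 2 the point yᵢ minimizes y ↦ (1/2)‖x − y‖₂² + tᵢ‖y‖₁ over the unit sphere S^{n−1}. Then |⟨y₁, x⟩ − ⟨y₂, x⟩| ≤ max(t₁, t₂)·‖y₁ − y₂‖₁. -/
open scoped RealInnerProductSpace

/-- `‖y‖₁ = Σᵢ |yᵢ|`. -/
noncomputable def normOne {n : ℕ} (y : EuclideanSpace ℝ (Fin n)) : ℝ :=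
  ∑ i, |y i|

lemma normOne_nonneg {n : ℕ} (y : EuclideanSpace ℝ (Fin n)) : 0 ≤ normOne y :=
  Finset.sum_nonneg fun _ _ => abs_nonneg _

lemma normOne_sub_comm {n : ℕ} (y z : EuclideanSpace ℝ (Fin n)) :
    normOne (y - z) = normOne (z - y) := by
  simp only [normOne, PiLp.sub_apply, abs_sub_comm]

lemma normOne_sub_normOne_le {n : ℕ} (y z : EuclideanSpace ℝ (Fin n)) :
    normOne y - normOne z ≤ normOne (y - z) := by
  simp only [normOne, ← Finset.sum_sub_distrib, PiLp.sub_apply]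
  exact Finset.sum_le_sum fun i _ => abs_sub_abs_le_abs_sub (y i) (z i)

/-- If the prox objective at a unit vector `y` is at most its value at a unit vector `z`, then
`⟨z,x⟩ - ⟨y,x⟩ ≤ t‖z - y‖₁`. -/
lemma inner_sub_inner_le_of_prox_le {n : ℕ} {x y z : EuclideanSpace ℝ (Fin n)} {t : ℝ}
    (hy : ‖y‖ = 1) (hz : ‖z‖ = 1) (ht : 0 ≤ t)
    (h : (1 / 2) * ‖x - y‖ ^ 2 + t * normOne y ≤ (1 / 2) * ‖x - z‖ ^ 2 + t * normOne z) :
    ⟪z, x⟫ - ⟪y, x⟫ ≤ t * normOne (z - y) := by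
  rw [norm_sub_sq_real, norm_sub_sq_real, hy, hz, real_inner_comm, real_inner_comm z x] at h
  have h_mul := mul_le_mul_of_nonneg_left (normOne_sub_normOne_le z y) ht
  linarith

/-- If `y₁, y₂` are unit-norm minimizers over the sphere of
`y ↦ (1/2)‖x - y‖² + tᵢ‖y‖₁` (for `i = 1, 2` respectively), then
`|⟨y₁,x⟩ - ⟨y₂,x⟩| ≤ max(t₁,t₂)·‖y₁ - y₂‖₁`. -/
theorem inner_diff_le_of_sphere_prox_minimizers {n : ℕ}
    (x y₁ y₂ : EuclideanSpace ℝ (Fin n))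
    (hx : ‖x‖ = 1) (hy₁ : ‖y₁‖ = 1) (hy₂ : ‖y₂‖ = 1)
    (t₁ t₂ : ℝ) (ht₁ : 0 ≤ t₁) (ht₂ : 0 ≤ t₂)
    (hmin₁ : ∀ y : EuclideanSpace ℝ (Fin n), ‖y‖ = 1 →
      (1 / 2) * ‖x - y₁‖ ^ 2 + t₁ * normOne y₁ ≤ (1 / 2) * ‖x - y‖ ^ 2 + t₁ * normOne y)
    (hmin₂ : ∀ y : EuclideanSpace ℝ (Fin n), ‖y‖ = 1 →
      (1 / 2) * ‖x - y₂‖ ^ 2 + t₂ * normOne y₂ ≤ (1 / 2) * ‖x - y‖ ^ 2 + t₂ * normOne y) :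
    |⟪y₁, x⟫ - ⟪y₂, x⟫| ≤ max t₁ t₂ * normOne (y₁ - y₂) := by
  have hN := normOne_nonneg (y₁ - y₂)
  refine abs_sub_le_iff.2 ⟨?_, ?_⟩
  · exact (inner_sub_inner_le_of_prox_le hy₂ hy₁ ht₂ (hmin₂ y₁ hy₁)).trans
      (mul_le_mul_of_nonneg_right (le_max_right t₁ t₂) hN)
  · have h := inner_sub_inner_le_of_prox_le hy₁ hy₂ ht₁ (hmin₁ y₂ hy₂)
    rw [normOne_sub_comm] at h
    exact h.trans (mul_le_mul_of_nonneg_right (le_max_left t₁ t₂) hN)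
end

section
/- Let x ∈ ℝⁿ with ‖x‖₂ = 1, let ξ ≥ 0, and let ȳ be a minimizer over the unit sphere S^{n−1} of φ(y) := (1/2)·arccos(⟨x,y⟩)² + ξ‖y‖₁. Then xᵢ·ȳᵢ ≥ 0 for every index i; that is, if xᵢ > 0 then ȳᵢ ≥ 0, and if xᵢ < 0 then ȳᵢ ≤ 0. -/
open scoped RealInnerProductSpace

/-- The vector `y` with the sign of its `i`-th coordinate flipped. -/
noncomputable def flipSign {n : ℕ} (i : Fin n) (y : EuclideanSpace ℝ (Fin n)) :
    EuclideanSpace ℝ (Fin n) :=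
  WithLp.toLp 2 fun j => if j = i then -y j else y j

theorem abs_flipSign_apply {n : ℕ} (i j : Fin n) (y : EuclideanSpace ℝ (Fin n)) :
    |flipSign i y j| = |y j| := by
  by_cases h : j = i <;> simp [flipSign, h]

theorem norm_flipSign {n : ℕ} (i : Fin n) (y : EuclideanSpace ℝ (Fin n)) :
    ‖flipSign i y‖ = ‖y‖ := by
  simp only [EuclideanSpace.norm_eq, Real.norm_eq_abs, abs_flipSign_apply]

theorem normOne_flipSign {n : ℕ} (i : Fin n) (y : EuclideanSpace ℝ (Fin n)) :
    normOne (flipSign i y) = normOne y := by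
  simp only [normOne, abs_flipSign_apply]

theorem inner_flipSign {n : ℕ} (i : Fin n) (x y : EuclideanSpace ℝ (Fin n)) :
    ⟪x, flipSign i y⟫ = ⟪x, y⟫ - 2 * (x i * y i) := by
  have h : flipSign i y = y - EuclideanSpace.single i (2 * y i) := by
    ext j
    by_cases hj : j = i
    · subst hj
      simp [flipSign]
      ring
    · simp [flipSign, hj]
  rw [h, inner_sub_right, EuclideanSpace.inner_single_right]
  simp
  ring

/-- If `ȳ` minimizes `φ(y) = (1/2)·arccos(⟨x,y⟩)² + ξ‖y‖₁` over the unit sphere,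
then `xᵢ·ȳᵢ ≥ 0` for every index `i`. -/
theorem sphere_prox_minimizer_sign {n : ℕ} (x ybar : EuclideanSpace ℝ (Fin n))
    (hx : ‖x‖ = 1) (hybar : ‖ybar‖ = 1) (ξ : ℝ) (hξ : 0 ≤ ξ)
    (hmin : ∀ y : EuclideanSpace ℝ (Fin n), ‖y‖ = 1 →
      (1 / 2) * Real.arccos ⟪x, ybar⟫ ^ 2 + ξ * normOne ybar ≤
        (1 / 2) * Real.arccos ⟪x, y⟫ ^ 2 + ξ * normOne y) :
    ∀ i, 0 ≤ x i * ybar i := by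
  intro i
  by_contra! hneg
  have hbound : ∀ y : EuclideanSpace ℝ (Fin n), ‖y‖ = 1 → ⟪x, y⟫ ∈ Set.Icc (-1 : ℝ) 1 := by
    intro y hy
    have h := abs_real_inner_le_norm x y
    rw [hx, hy, one_mul] at h
    exact abs_le.mp h
  have hflip : ‖flipSign i ybar‖ = 1 := (norm_flipSign i ybar).trans hybar
  have hinner : ⟪x, ybar⟫ < ⟪x, flipSign i ybar⟫ := by
    rw [inner_flipSign]
    linarith
  have hlt := Real.strictAntiOn_arccos (hbound _ hybar) (hbound _ hflip) hinner
  have hsq := pow_lt_pow_left₀ hlt (Real.arccos_nonneg _) two_ne_zero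
  have h := hmin _ hflip
  rw [normOne_flipSign] at h
  linarith
end

section
/- Let x ∈ ℝⁿ with ‖x‖₂ = 1 and let ξ satisfy 0 < ξ < ‖x‖∞ and 4ξ²·‖x‖₀/((‖x‖∞ − ξ)·π²) < 1. Then the minimizer over the unit sphere S^{n−1} of φ(y) := (1/2)·arccos(⟨x,y⟩)² + ξ‖y‖₁ is unique; that is, if ȳ₁ and ȳ₂ are both minimizers of φ over S^{n−1}, then ȳ₁ = ȳ₂. -/
open scoped RealInnerProductSpace

/-- `‖x‖₀`, the number of nonzero entries of `x`. -/
noncomputable def normZero {n : ℕ} (x : EuclideanSpace ℝ (Fin n)) : ℕ :=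
  (Finset.univ.filter fun i => x i ≠ 0).card

/-- `‖x‖∞ = maxᵢ |xᵢ|`. -/
noncomputable def normInf {n : ℕ} (x : EuclideanSpace ℝ (Fin n)) : ℝ :=
  ⨆ i, |x i|

/-- `½ arccos²` is convex on `[-1, 1]`. -/
lemma convexOn_half_arccos_sq :
    ConvexOn ℝ (Set.Icc (-1) 1) fun c : ℝ => (1 / 2) * Real.arccos c ^ 2 := by
  have hderiv : ∀ c ∈ Set.Ioo (-1 : ℝ) 1,
      HasDerivAt (fun c : ℝ => (1 / 2) * Real.arccos c ^ 2)
        (-(Real.arccos c / Real.sin (Real.arccos c))) c := by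
    intro c hc
    have h := ((Real.hasDerivAt_arccos hc.1.ne' hc.2.ne).pow 2).const_mul (1 / 2 : ℝ)
    refine h.congr_deriv ?_
    rw [Real.sin_arccos]
    norm_num
    ring
  refine MonotoneOn.convexOn_of_deriv (convex_Icc _ _)
    (by fun_prop) ?_ ?_
  · rw [interior_Icc]
    exact fun c hc => (hderiv c hc).differentiableAt.differentiableWithinAt
  · rw [interior_Icc]
    intro a ha b hb hab
    rw [(hderiv a ha).deriv, (hderiv b hb).deriv, neg_le_neg_iff]
    have hpos : ∀ c ∈ Set.Ioo (-1 : ℝ) 1, 0 < Real.sin (Real.arccos c) := fun c hc => by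
      rw [Real.sin_arccos]
      exact Real.sqrt_pos.2 (by nlinarith [hc.1, hc.2])
    rw [div_le_div_iff₀ (hpos b hb) (hpos a ha)]
    have hs : 0 < Real.arccos b := Real.arccos_pos.2 hb.2
    have hst : Real.arccos b ≤ Real.arccos a := Real.antitone_arccos hab
    have ht : 0 < Real.arccos a := hs.trans_le hst
    have h := strictConcaveOn_sin_Icc.concaveOn.2
      ⟨ht.le, Real.arccos_le_pi a⟩ ⟨le_rfl, Real.pi_pos.le⟩
      (show 0 ≤ Real.arccos b / Real.arccos a by positivity)
      (show 0 ≤ 1 - Real.arccos b / Real.arccos a by rwa [sub_nonneg, div_le_one ht]) (by ring)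
    simp only [smul_eq_mul, Real.sin_zero, mul_zero, add_zero, div_mul_cancel₀ _ ht.ne'] at h
    rw [div_mul_eq_mul_div, div_le_iff₀ ht] at h
    linarith

/-- `½ arccos²` decreases with slope at most `-1` on `[-1, 1]`. -/
lemma half_arccos_sq_add_le {a b : ℝ} (ha : -1 ≤ a) (hab : a ≤ b) (hb : b ≤ 1) :
    (1 / 2) * Real.arccos b ^ 2 + b ≤ (1 / 2) * Real.arccos a ^ 2 + a := by
  have hderiv : ∀ d : ℝ, HasDerivAt (fun d : ℝ => (1 / 2) * d ^ 2 + Real.cos d)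
      (d - Real.sin d) d := fun d => by
    refine (((hasDerivAt_id d).pow 2).const_mul (1 / 2 : ℝ)).add (Real.hasDerivAt_cos d)
      |>.congr_deriv ?_
    norm_num
    ring
  have hmono : MonotoneOn (fun d : ℝ => (1 / 2) * d ^ 2 + Real.cos d) (Set.Ici 0) := by
    refine monotoneOn_of_deriv_nonneg (convex_Ici 0) (by fun_prop)
      (fun d _ => (hderiv d).differentiableAt.differentiableWithinAt) fun d hd => ?_
    rw [interior_Ici] at hd
    rw [(hderiv d).deriv]
    exact sub_nonneg.2 (Real.sin_le hd.le)
  have h := hmono (Real.arccos_nonneg b) (Real.arccos_nonneg a) (Real.antitone_arccos hab)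
  simpa only [Real.cos_arccos ha (hab.trans hb), Real.cos_arccos (ha.trans hab) hb] using h

lemma normOne_add_le {n : ℕ} (y z : EuclideanSpace ℝ (Fin n)) :
    normOne (y + z) ≤ normOne y + normOne z := by
  simp only [normOne, ← Finset.sum_add_distrib, PiLp.add_apply]
  exact Finset.sum_le_sum fun i _ => abs_add_le _ _

lemma normOne_smul {n : ℕ} (a : ℝ) (y : EuclideanSpace ℝ (Fin n)) :
    normOne (a • y) = |a| * normOne y := by
  simp [normOne, Finset.mul_sum, abs_mul]

lemma normOne_single {n : ℕ} (i : Fin n) (a : ℝ) :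
    normOne (EuclideanSpace.single i a) = |a| := by
  rw [normOne, Finset.sum_eq_single i] <;> simp +contextual

lemma inner_mem_Icc_of_norm_le_one {E : Type*} [NormedAddCommGroup E] [InnerProductSpace ℝ E]
    {x y : E} (hx : ‖x‖ ≤ 1) (hy : ‖y‖ ≤ 1) : ⟪x, y⟫ ∈ Set.Icc (-1 : ℝ) 1 :=
  abs_le.1 ((abs_real_inner_le_norm x y).trans (mul_le_one₀ hx (norm_nonneg y) hy))

/-- A ray starting in the open unit ball in a unit direction meets the unit sphere. -/
lemma exists_pos_norm_add_smul_eq_one {E : Type*} [NormedAddCommGroup E] [NormedSpace ℝ E]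
    {z e : E} (hz : ‖z‖ < 1) (he : ‖e‖ = 1) : ∃ t : ℝ, 0 < t ∧ ‖z + t • e‖ = 1 := by
  have hcont : ContinuousOn (fun t : ℝ => ‖z + t • e‖) (Set.Icc 0 2) := by fun_prop
  have htwo : 1 ≤ ‖z + (2 : ℝ) • e‖ := by
    have h := norm_sub_le (z + (2 : ℝ) • e) z
    rw [add_sub_cancel_left, norm_smul, he] at h
    norm_num at h
    linarith
  obtain ⟨t, ht, hnorm⟩ := intermediate_value_Icc (by norm_num : (0 : ℝ) ≤ 2) hcont
    (show (1 : ℝ) ∈ Set.Icc _ _ from ⟨by simpa using hz.le, htwo⟩)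
  refine ⟨t, ht.1.lt_of_ne ?_, hnorm⟩
  rintro rfl
  simp only [zero_smul, add_zero] at hnorm
  exact hz.ne hnorm

/-- Points in the open unit ball are not minimizers over the closed ball: the unit sphere always
contains a point with a strictly smaller value of the objective. -/
lemma exists_norm_eq_one_objective_lt {n : ℕ} {x z : EuclideanSpace ℝ (Fin n)} (hx : ‖x‖ = 1)
    {ξ : ℝ} (hξ : 0 < ξ) (hξ' : ξ < normInf x) (hz : ‖z‖ < 1) :
    ∃ y : EuclideanSpace ℝ (Fin n), ‖y‖ = 1 ∧
      (1 / 2) * Real.arccos ⟪x, y⟫ ^ 2 + ξ * normOne y <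
        (1 / 2) * Real.arccos ⟪x, z⟫ ^ 2 + ξ * normOne z := by
  have : Nonempty (Fin n) := by
    by_contra h
    rw [not_nonempty_iff] at h
    simp [Subsingleton.elim x 0] at hx
  obtain ⟨i, hi⟩ := exists_lt_of_lt_ciSup hξ'
  have hxi : x i ≠ 0 := abs_pos.1 (hξ.trans hi)
  obtain ⟨a, ha, hax⟩ : ∃ a : ℝ, |a| = 1 ∧ a * x i = |x i| := by
    rcases abs_choice (x i) with h | h
    · exact ⟨1, by simp, by rw [h, one_mul]⟩
    · exact ⟨-1, by simp, by rw [h, neg_one_mul]⟩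
  obtain ⟨t, ht, hnorm⟩ := exists_pos_norm_add_smul_eq_one
    (e := EuclideanSpace.single i a) hz (by simpa using ha)
  refine ⟨_, hnorm, ?_⟩
  have hinner : ⟪x, z + t • EuclideanSpace.single i a⟫ = ⟪x, z⟫ + t * |x i| := by
    rw [inner_add_right, inner_smul_right, EuclideanSpace.inner_single_right, ← hax]
    simp
  have hslope := half_arccos_sq_add_le (inner_mem_Icc_of_norm_le_one hx.le hz.le).1
    (b := ⟪x, z + t • EuclideanSpace.single i a⟫)
    (by rw [hinner]; exact le_add_of_nonneg_right (by positivity))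
    (inner_mem_Icc_of_norm_le_one hx.le hnorm.le).2
  have hone := normOne_add_le z (t • EuclideanSpace.single i a)
  rw [normOne_smul, normOne_single, ha, abs_of_pos ht, mul_one] at hone
  have h₁ := mul_le_mul_of_nonneg_left hone hξ.le
  have h₂ := mul_lt_mul_of_pos_left hi ht
  linarith

/-- For a unit vector `x` and `0 < ξ < ‖x‖∞` with `4ξ²‖x‖₀/((‖x‖∞ - ξ)π²) < 1`,
the minimizer over the unit sphere of `φ(y) = (1/2)·arccos(⟨x,y⟩)² + ξ‖y‖₁`
is unique. -/
theorem sphere_prox_minimizer_unique {n : ℕ} (x : EuclideanSpace ℝ (Fin n)) (hx : ‖x‖ = 1)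
    (ξ : ℝ) (hξ : 0 < ξ) (hξ' : ξ < normInf x)
    (hq : 4 * ξ ^ 2 * (normZero x : ℝ) / ((normInf x - ξ) * Real.pi ^ 2) < 1)
    (y₁ y₂ : EuclideanSpace ℝ (Fin n)) (hy₁ : ‖y₁‖ = 1) (hy₂ : ‖y₂‖ = 1)
    (hmin₁ : ∀ y : EuclideanSpace ℝ (Fin n), ‖y‖ = 1 →
      (1 / 2) * Real.arccos ⟪x, y₁⟫ ^ 2 + ξ * normOne y₁ ≤
        (1 / 2) * Real.arccos ⟪x, y⟫ ^ 2 + ξ * normOne y)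
    (hmin₂ : ∀ y : EuclideanSpace ℝ (Fin n), ‖y‖ = 1 →
      (1 / 2) * Real.arccos ⟪x, y₂⟫ ^ 2 + ξ * normOne y₂ ≤
        (1 / 2) * Real.arccos ⟪x, y⟫ ^ 2 + ξ * normOne y) :
    y₁ = y₂ := by
  by_contra hne
  have hz : ‖(1 / 2 : ℝ) • y₁ + (1 / 2 : ℝ) • y₂‖ < 1 := by
    have hpar := parallelogram_law_with_norm ℝ y₁ y₂
    have hpos : 0 < ‖y₁ - y₂‖ := norm_pos_iff.2 (sub_ne_zero.2 hne)
    rw [hy₁, hy₂] at hpar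
    rw [← smul_add, norm_smul, Real.norm_of_nonneg (by norm_num)]
    nlinarith [norm_nonneg (y₁ + y₂)]
  obtain ⟨y, hy, hlt⟩ := exists_norm_eq_one_objective_lt hx hξ hξ' hz
  have hconv := convexOn_half_arccos_sq.2 (inner_mem_Icc_of_norm_le_one hx.le hy₁.le)
    (inner_mem_Icc_of_norm_le_one hx.le hy₂.le) (by norm_num : (0 : ℝ) ≤ 1 / 2)
    (by norm_num : (0 : ℝ) ≤ 1 / 2) (by norm_num)
  have hone := mul_le_mul_of_nonneg_left
    (normOne_add_le ((1 / 2 : ℝ) • y₁) ((1 / 2 : ℝ) • y₂)) hξ.le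
  rw [normOne_smul, normOne_smul, abs_of_pos (by norm_num : (0 : ℝ) < 1 / 2)] at hone
  rw [inner_add_right, inner_smul_right, inner_smul_right] at hlt
  simp only [smul_eq_mul] at hconv
  linarith [hmin₁ y hy, hmin₂ y hy]
end

section
/- Let E be a real inner product space, let g, h : E → ℝ, let p, q ∈ E, let λ > 0 and L ≥ 0. Suppose g is differentiable at p with gradient ∇g(p) ∈ E and that the quadratic upper bound g(q) ≤ g(p) + ⟨∇g(p), q − p⟩ + (L/2)‖q − p‖² holds. If q satisfies the proximal descent condition h(q) + (1/(2λ))·‖q − (p − λ∇g(p))‖² ≤ h(p) + (λ/2)·‖∇g(p)‖², then (g + h)(p) − (g + h)(q) ≥ ((1/λ − L)/2)·‖p − q‖². -/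
open scoped RealInnerProductSpace

/-- Euclidean sufficient-decrease lemma for the nonconvex proximal gradient method:
if `g` is differentiable at `p` with gradient `gradg` and satisfies the quadratic
upper bound at `q`, and `q` satisfies the proximal descent condition
`H(q) ≤ H(p)`, then `(g+h)(p) - (g+h)(q) ≥ ((1/λ - L)/2)·‖p - q‖²`. -/
theorem prox_grad_sufficient_decrease
    {E : Type*} [NormedAddCommGroup E] [InnerProductSpace ℝ E]
    (g h : E → ℝ) (p q : E) (lam L : ℝ) (hlam : 0 < lam) (hL : 0 ≤ L)
    (gradg : E)
    (hdiff : HasFDerivAt g ((innerSL ℝ) gradg) p)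
    (hquad : g q ≤ g p + ⟪gradg, q - p⟫ + L / 2 * ‖q - p‖ ^ 2)
    (hprox : h q + 1 / (2 * lam) * ‖q - (p - lam • gradg)‖ ^ 2 ≤
      h p + lam / 2 * ‖gradg‖ ^ 2) :
    (g p + h p) - (g q + h q) ≥ (1 / lam - L) / 2 * ‖p - q‖ ^ 2 := by
  have hexpand : 1 / (2 * lam) * ‖q - (p - lam • gradg)‖ ^ 2 =
      1 / lam / 2 * ‖q - p‖ ^ 2 + ⟪gradg, q - p⟫ + lam / 2 * ‖gradg‖ ^ 2 := by
    rw [← sub_add, norm_add_sq_real, real_inner_smul_right, norm_smul, mul_pow,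
      Real.norm_eq_abs, sq_abs, real_inner_comm]
    field_simp
  rw [norm_sub_rev p q]
  linarith
end

section
/- Let E be a real inner product space, let g : E → ℝ be differentiable with gradient map ∇g : E → E satisfying ‖∇g(u) − ∇g(v)‖ ≤ L‖u − v‖ for all u, v ∈ E and some L > 0, let h : E → ℝ, set f := g + h, and suppose f(u) ≥ f* for all u ∈ E and some f* ∈ ℝ. Fix a stepsize λ ∈ (0, 1/L) and a sequence (p_k) in E such that for every k: h(p_{k+1}) + (1/(2λ))·‖p_{k+1} − (p_k − λ∇g(p_k))‖² ≤ h(p_k) + (λ/2)·‖∇g(p_k)‖². Define the gradient mapping G_k := (p_k − p_{k+1})/λ and M := (λ − λ²L)/2 > 0. Then for every k ≥ 0: min_{0 ≤ n ≤ k} ‖G_n‖ ≤ √((f(p₀) − f*)/(M·(k + 1))). -/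
open scoped RealInnerProductSpace

/-- Descent lemma: a function whose gradient is `L`-Lipschitz lies below its quadratic model. -/
theorem le_add_inner_add_sq_of_lipschitz_gradient
    {E : Type*} [NormedAddCommGroup E] [InnerProductSpace ℝ E]
    {g : E → ℝ} {gradg : E → E} {L : ℝ}
    (hdiff : ∀ u : E, HasFDerivAt g ((innerSL ℝ) (gradg u)) u)
    (hlip : ∀ u v : E, ‖gradg u - gradg v‖ ≤ L * ‖u - v‖) (u d : E) :
    g (u + d) ≤ g u + ⟪gradg u, d⟫ + L / 2 * ‖d‖ ^ 2 := by
  have hg (t : ℝ) : HasDerivAt (fun t : ℝ => g (u + t • d)) ⟪gradg (u + t • d), d⟫ t := by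
    have hline : HasDerivAt (fun t : ℝ => u + t • d) d t := by
      simpa using ((hasDerivAt_id t).smul_const d).const_add u
    exact (hdiff (u + t • d)).comp_hasDerivAt t hline
  have hmodel (t : ℝ) :
      HasDerivAt (fun t : ℝ => g u + t * ⟪gradg u, d⟫ + L / 2 * ‖d‖ ^ 2 * t ^ 2)
        (⟪gradg u, d⟫ + L * ‖d‖ ^ 2 * t) t := by
    refine (((hasDerivAt_id' t).mul_const ⟪gradg u, d⟫).const_add (g u)).add
      (((hasDerivAt_id' t).fun_pow 2).const_mul (L / 2 * ‖d‖ ^ 2)) |>.congr_deriv ?_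
    norm_num
    ring
  have hle := image_le_of_deriv_right_le_deriv_boundary (a := 0) (b := 1)
    (fun t _ => (hg t).continuousAt.continuousWithinAt)
    (fun t _ => (hg t).hasDerivWithinAt) (by simp)
    (fun t _ => (hmodel t).continuousAt.continuousWithinAt)
    (fun t _ => (hmodel t).hasDerivWithinAt)
    (fun t ht => by
      have hinner : ⟪gradg (u + t • d), d⟫ - ⟪gradg u, d⟫ ≤ L * ‖d‖ ^ 2 * t := by
        calc ⟪gradg (u + t • d), d⟫ - ⟪gradg u, d⟫
            = ⟪gradg (u + t • d) - gradg u, d⟫ := (inner_sub_left _ _ _).symm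
          _ ≤ ‖gradg (u + t • d) - gradg u‖ * ‖d‖ := real_inner_le_norm _ _
          _ ≤ L * ‖u + t • d - u‖ * ‖d‖ := by gcongr; exact hlip _ _
          _ = L * ‖d‖ ^ 2 * t := by
            rw [add_sub_cancel_left, norm_smul, Real.norm_of_nonneg ht.1]
            ring
      linarith)
    (Set.right_mem_Icc.2 zero_le_one)
  simpa using hle

/-- Sufficient decrease of `g + h` along one proximal gradient step. -/
theorem sufficient_decrease_of_prox_grad_step
    {E : Type*} [NormedAddCommGroup E] [InnerProductSpace ℝ E]
    {g h : E → ℝ} {gradg : E → E} {L lam : ℝ}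
    (hdiff : ∀ u : E, HasFDerivAt g ((innerSL ℝ) (gradg u)) u)
    (hlip : ∀ u v : E, ‖gradg u - gradg v‖ ≤ L * ‖u - v‖) (hlam : 0 < lam) {u v : E}
    (hstep : h v + 1 / (2 * lam) * ‖v - (u - lam • gradg u)‖ ^ 2 ≤
      h u + lam / 2 * ‖gradg u‖ ^ 2) :
    (lam - lam ^ 2 * L) / 2 * ‖lam⁻¹ • (u - v)‖ ^ 2 ≤ (g u + h u) - (g v + h v) := by
  have hdescent := le_add_inner_add_sq_of_lipschitz_gradient hdiff hlip u (v - u)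
  rw [add_sub_cancel] at hdescent
  have hexpand : 1 / (2 * lam) * ‖v - (u - lam • gradg u)‖ ^ 2 =
      1 / (2 * lam) * ‖v - u‖ ^ 2 + ⟪gradg u, v - u⟫ + lam / 2 * ‖gradg u‖ ^ 2 := by
    rw [← sub_add, norm_add_sq_real, real_inner_smul_right, real_inner_comm, norm_smul,
      Real.norm_of_nonneg hlam.le]
    field_simp
  have hscale : (lam - lam ^ 2 * L) / 2 * ‖lam⁻¹ • (u - v)‖ ^ 2 =
      1 / (2 * lam) * ‖v - u‖ ^ 2 - L / 2 * ‖v - u‖ ^ 2 := by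
    rw [norm_smul, norm_sub_rev, Real.norm_of_nonneg (inv_nonneg.2 hlam.le)]
    field_simp
  linarith

/-- Euclidean sublinear `O(1/√k)` complexity bound for the nonconvex proximal
gradient method with constant stepsize `λ ∈ (0, 1/L)`: with gradient mapping
`G_n := (p_n - p_{n+1})/λ` and `M := (λ - λ²L)/2`, one has
`min_{0 ≤ n ≤ k} ‖G_n‖ ≤ √((f(p₀) - f*)/(M(k+1)))`. -/
theorem prox_grad_complexity
    {E : Type*} [NormedAddCommGroup E] [InnerProductSpace ℝ E]
    (g h : E → ℝ) (gradg : E → E) (L : ℝ) (hL : 0 < L)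
    (hdiff : ∀ u : E, HasFDerivAt g ((innerSL ℝ) (gradg u)) u)
    (hlip : ∀ u v : E, ‖gradg u - gradg v‖ ≤ L * ‖u - v‖)
    (fstar : ℝ) (hbdd : ∀ u : E, fstar ≤ g u + h u)
    (lam : ℝ) (hlam : 0 < lam) (hlamL : lam < 1 / L)
    (p : ℕ → E)
    (hstep : ∀ k : ℕ,
      h (p (k + 1)) + 1 / (2 * lam) * ‖p (k + 1) - (p k - lam • gradg (p k))‖ ^ 2 ≤
        h (p k) + lam / 2 * ‖gradg (p k)‖ ^ 2) :
    ∀ k : ℕ, ∃ n ≤ k,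
      ‖lam⁻¹ • (p n - p (n + 1))‖ ≤
        Real.sqrt ((g (p 0) + h (p 0) - fstar) / ((lam - lam ^ 2 * L) / 2 * (k + 1))) := by
  intro k
  have hM : 0 < (lam - lam ^ 2 * L) / 2 := by
    have : lam * L < 1 := (lt_div_iff₀ hL).1 hlamL
    nlinarith
  have hsum : ∑ n ∈ Finset.range (k + 1),
      (lam - lam ^ 2 * L) / 2 * ‖lam⁻¹ • (p n - p (n + 1))‖ ^ 2 ≤ g (p 0) + h (p 0) - fstar :=
    calc _ ≤ ∑ n ∈ Finset.range (k + 1),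
          ((g (p n) + h (p n)) - (g (p (n + 1)) + h (p (n + 1)))) :=
          Finset.sum_le_sum fun n _ =>
            sufficient_decrease_of_prox_grad_step hdiff hlip hlam (hstep n)
      _ = (g (p 0) + h (p 0)) - (g (p (k + 1)) + h (p (k + 1))) :=
          Finset.sum_range_sub' (fun n => g (p n) + h (p n)) (k + 1)
      _ ≤ _ := sub_le_sub_left (hbdd _) _
  obtain ⟨n, hn, hmin⟩ := Finset.exists_min_image (Finset.range (k + 1))
    (fun n => (lam - lam ^ 2 * L) / 2 * ‖lam⁻¹ • (p n - p (n + 1))‖ ^ 2) ⟨0, by simp⟩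
  refine ⟨n, Nat.lt_succ_iff.1 (Finset.mem_range.1 hn), Real.le_sqrt_of_sq_le ?_⟩
  have hcard := (Finset.card_nsmul_le_sum _ _ _ hmin).trans hsum
  rw [Finset.card_range, nsmul_eq_mul] at hcard
  push_cast at hcard
  rw [le_div_iff₀ (by positivity)]
  linarith
end
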